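/- Stability certificate: let K be a stabilizing gain (ρ(A + BK) < 1), let Q_K ≻ 0 be any positive definite matrix, and set P := 𝕃((A+BK)ᵀ, Q_K). Then for any direction G ∈ M(m×n, ℝ) and any stepsize η with 0 ≤ η ≤ λ_min(Q_K) / (2 λ_max(P) ‖BG‖₂), the updated gain K⁺ := K + ηG is also stabilizing, i.e. ρ(A + B K⁺) < 1. -/

import Mathlib

open Matrix

/-- Spectral radius of a real square matrix, computed over the complex eigenvalues. -/
noncomputable def specRad {n : ℕ} (A : Matrix (Fin n) (Fin n) ℝ) : ENNReal :=
  spectralRadius ℂ (A.map (algebraMap ℝ ℂ))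

/-- Spectral norm (ℓ²-operator norm) of a real square matrix. -/
noncomputable def specNorm {n : ℕ} (M : Matrix (Fin n) (Fin n) ℝ) : ℝ :=
  ‖(Matrix.toEuclideanLin M).toContinuousLinearMap‖

open Filter Topology

section normed
attribute [local instance] Matrix.linftyOpNormedRing Matrix.linftyOpNormedAlgebra

lemma sc_pow_tendsto {n : ℕ} (M : Matrix (Fin n) (Fin n) ℂ) (h : spectralRadius ℂ M < 1) :
    Tendsto (fun k : ℕ => M ^ k) atTop (𝓝 0) := by
  have hg := spectrum.pow_nnnorm_pow_one_div_tendsto_nhds_spectralRadius M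
  obtain ⟨r, hr1, hr2⟩ := ENNReal.lt_iff_exists_nnreal_btwn.1 h
  have hev := hg.eventually_lt_const hr1
  refine (tendsto_zero_iff_norm_tendsto_zero (f := fun k : ℕ => M ^ k)).2 ?_
  have hr2' : (r : ℝ) < 1 := by exact_mod_cast hr2
  refine squeeze_zero' (Eventually.of_forall fun _ => norm_nonneg _) ?_
    (tendsto_pow_atTop_nhds_zero_of_lt_one r.2 hr2')
  filter_upwards [hev, eventually_gt_atTop 0] with k hk hk0
  have h1 : ((‖M ^ k‖₊ : ENNReal) ^ (1 / k : ℝ)) ^ (k : ℝ) ≤ (r : ENNReal) ^ (k : ℝ) :=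
    ENNReal.rpow_le_rpow hk.le (by positivity)
  rw [← ENNReal.rpow_mul, one_div, inv_mul_cancel₀ (by positivity), ENNReal.rpow_one,
    ENNReal.rpow_natCast] at h1
  have h2 : ‖M ^ k‖₊ ≤ r ^ k := by exact_mod_cast h1
  exact_mod_cast h2

lemma sc_specRad_lt {n : ℕ} (M : Matrix (Fin n) (Fin n) ℂ)
    (h : ∀ z ∈ spectrum ℂ M, ‖z‖ < 1) : spectralRadius ℂ M < 1 := by
  rcases (spectrum ℂ M).eq_empty_or_nonempty with he | hne
  · simp [spectralRadius, he]
  · have := spectrum.spectralRadius_lt_of_forall_lt_of_nonempty (𝕜 := ℂ) (a := M) hne (r := 1)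
      (fun k hk => by have := h k hk; exact_mod_cast this)
    simpa using this
end normed

/-- The quadratic form. -/
noncomputable def scV {n : ℕ} (P : Matrix (Fin n) (Fin n) ℝ) (x y : Fin n → ℝ) : ℝ :=
  x ⬝ᵥ (P *ᵥ y)

lemma scV_add_left {n : ℕ} (P : Matrix (Fin n) (Fin n) ℝ) (x y z : Fin n → ℝ) :
    scV P (x + y) z = scV P x z + scV P y z := by simp [scV, add_dotProduct]
lemma scV_add_right {n : ℕ} (P : Matrix (Fin n) (Fin n) ℝ) (x y z : Fin n → ℝ) :
    scV P z (x + y) = scV P z x + scV P z y := by simp [scV, mulVec_add, dotProduct_add]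
lemma scV_smul_left {n : ℕ} (P : Matrix (Fin n) (Fin n) ℝ) (c : ℝ) (x z : Fin n → ℝ) :
    scV P (c • x) z = c * scV P x z := by simp [scV]
lemma scV_smul_right {n : ℕ} (P : Matrix (Fin n) (Fin n) ℝ) (c : ℝ) (x z : Fin n → ℝ) :
    scV P z (c • x) = c * scV P z x := by simp [scV, mulVec_smul]
lemma scV_symm {n : ℕ} {P : Matrix (Fin n) (Fin n) ℝ} (hP : P.IsHermitian) (x y : Fin n → ℝ) :
    scV P x y = scV P y x := by
  have h : Pᵀ = P := by simpa [Matrix.IsHermitian] using hP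
  unfold scV
  rw [dotProduct_mulVec, ← mulVec_transpose, h, dotProduct_comm]

/-- The Lyapunov criterion. -/
lemma sc_lyap {n : ℕ} (N P : Matrix (Fin n) (Fin n) ℝ) (hP : P.IsHermitian)
    (hpos : ∀ x, x ≠ 0 → 0 < scV P x x)
    (hdec : ∀ x, x ≠ 0 → scV P (N *ᵥ x) (N *ᵥ x) < scV P x x) : specRad N < 1 := by
  apply sc_specRad_lt
  intro z hz
  rw [← Matrix.spectrum_toLin', ← Module.End.hasEigenvalue_iff_mem_spectrum] at hz
  obtain ⟨v, hv⟩ := hz.exists_hasEigenvector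
  have hv0 := hv.2
  have hvz := hv.apply_eq_smul
  rw [Matrix.toLin'_apply] at hvz
  set x : Fin n → ℝ := fun i => (v i).re with hx
  set y : Fin n → ℝ := fun i => (v i).im with hy
  have hNx : N *ᵥ x = z.re • x + (-z.im) • y := by
    ext i
    have := congrArg Complex.re (congrFun hvz i)
    simp [Matrix.mulVec, dotProduct] at this
    simp [Matrix.mulVec, dotProduct, hx, hy, this]
    ring
  have hNy : N *ᵥ y = z.im • x + z.re • y := by
    ext i
    have := congrArg Complex.im (congrFun hvz i)
    simp [Matrix.mulVec, dotProduct] at this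
    simp [Matrix.mulVec, dotProduct, hx, hy, this]
    ring
  have hxy : x ≠ 0 ∨ y ≠ 0 := by
    by_contra! hc
    apply hv0
    ext i
    exact Complex.ext (congrFun hc.1 i) (congrFun hc.2 i)
  have hV0 : scV P 0 0 = 0 := by simp [scV]
  have hnn : ∀ x, 0 ≤ scV P x x := by
    intro x
    by_cases h : x = 0
    · rw [h, hV0]
    · exact (hpos x h).le
  have hde : ∀ x, scV P (N *ᵥ x) (N *ᵥ x) ≤ scV P x x := by
    intro x
    by_cases h : x = 0
    · simp [h]
    · exact (hdec x h).le
  have hsum : 0 < scV P x x + scV P y y ∧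
      scV P (N *ᵥ x) (N *ᵥ x) + scV P (N *ᵥ y) (N *ᵥ y) < scV P x x + scV P y y := by
    rcases hxy with h | h
    · have := hpos x h; have := hdec x h; have := hnn y; have := hde y
      constructor <;> linarith
    · have := hpos y h; have := hdec y h; have := hnn x; have := hde x
      constructor <;> linarith
  obtain ⟨h1, h2⟩ := hsum
  rw [hNx, hNy] at h2
  simp only [scV_add_left, scV_add_right, scV_smul_left, scV_smul_right, scV_symm hP y x] at h2
  have h3 : (z.re ^ 2 + z.im ^ 2) * (scV P x x + scV P y y) < 1 * (scV P x x + scV P y y) := by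
    nlinarith
  have h4 := lt_of_mul_lt_mul_right h3 h1.le
  have h5 : ‖z‖ ^ 2 < 1 := by
    rw [Complex.sq_norm, Complex.normSq_apply]; linarith
  nlinarith [norm_nonneg z]

lemma sc_rayleigh {n : ℕ} {A : Matrix (Fin n) (Fin n) ℝ} (hA : A.IsHermitian) (x : Fin n → ℝ) :
    ∃ c : Fin n → ℝ, scV A x x = ∑ i, hA.eigenvalues i * c i ^ 2 ∧ x ⬝ᵥ x = ∑ i, c i ^ 2 := by
  set b := hA.eigenvectorBasis
  refine ⟨fun i => inner ℝ (b i) (WithLp.toLp 2 x), ?_, ?_⟩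
  · have h := b.sum_inner_mul_inner (WithLp.toLp 2 x) (WithLp.toLp 2 (A *ᵥ x))
    have e : inner ℝ (WithLp.toLp 2 x) (WithLp.toLp 2 (A *ᵥ x)) = scV A x x := by
      simp [scV, EuclideanSpace.inner_eq_star_dotProduct, dotProduct_comm]
    rw [← e, ← h]
    refine Finset.sum_congr rfl fun i _ => ?_
    have e2 : inner ℝ (b i) (WithLp.toLp 2 (A *ᵥ x))
        = hA.eigenvalues i * inner ℝ (b i) (WithLp.toLp 2 x) := by
      have h1 : inner ℝ (b i) (WithLp.toLp 2 (A *ᵥ x)) = scV A (b i).ofLp x := by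
        simp [scV, EuclideanSpace.inner_eq_star_dotProduct, dotProduct_comm]
      rw [h1, scV_symm hA]
      unfold scV
      rw [hA.mulVec_eigenvectorBasis i]
      simp [EuclideanSpace.inner_eq_star_dotProduct, b]
    rw [e2, real_inner_comm]
    ring
  · have h := b.sum_inner_mul_inner (WithLp.toLp 2 x) (WithLp.toLp 2 x)
    have e : inner ℝ (WithLp.toLp 2 x) (WithLp.toLp 2 x) = x ⬝ᵥ x := by
      rw [EuclideanSpace.inner_eq_star_dotProduct]; simp
    rw [← e, ← h]
    refine Finset.sum_congr rfl fun i _ => ?_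
    rw [real_inner_comm]
    ring

lemma sc_le_max {n : ℕ} {A : Matrix (Fin n) (Fin n) ℝ} (hA : A.IsHermitian) (x : Fin n → ℝ) :
    scV A x x ≤ (⨆ i, hA.eigenvalues i) * (x ⬝ᵥ x) := by
  obtain ⟨c, h1, h2⟩ := sc_rayleigh hA x
  rw [h1, h2, Finset.mul_sum]
  gcongr with i
  exact le_ciSup (Set.finite_range _).bddAbove i

lemma sc_min_le {n : ℕ} {A : Matrix (Fin n) (Fin n) ℝ} (hA : A.IsHermitian) (x : Fin n → ℝ) :
    (⨅ i, hA.eigenvalues i) * (x ⬝ᵥ x) ≤ scV A x x := by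
  obtain ⟨c, h1, h2⟩ := sc_rayleigh hA x
  rw [h1, h2, Finset.mul_sum]
  gcongr with i
  exact ciInf_le (Set.finite_range _).bddBelow i

lemma sc_pos {n : ℕ} (M P Q : Matrix (Fin n) (Fin n) ℝ) (hM : specRad M < 1)
    (hdec : ∀ x, scV P (M *ᵥ x) (M *ᵥ x) = scV P x x - scV Q x x)
    (hQ : ∀ x, x ≠ 0 → 0 < scV Q x x) (x : Fin n → ℝ) (hx : x ≠ 0) : 0 < scV P x x := by
  have hde : ∀ x, scV P (M *ᵥ x) (M *ᵥ x) ≤ scV P x x := by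
    intro x
    by_cases h : x = 0
    · simp [h]
    · linarith [hQ x h, hdec x]
  have hk : ∀ k : ℕ, scV P ((M ^ (k + 1)) *ᵥ x) ((M ^ (k + 1)) *ᵥ x) ≤ scV P (M *ᵥ x) (M *ᵥ x) := by
    intro k
    induction k with
    | zero => simp
    | succ k ih =>
      rw [pow_succ' M (k + 1), ← mulVec_mulVec]
      exact (hde _).trans ih
  have ht := sc_pow_tendsto _ hM
  have hMk : ∀ k, M ^ k = ((M.map (algebraMap ℝ ℂ)) ^ k).map Complex.re := by
    intro k
    have : (M.map (algebraMap ℝ ℂ)) ^ k = (M ^ k).map (algebraMap ℝ ℂ) :=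
      (map_pow (algebraMap ℝ ℂ).mapMatrix M k).symm
    rw [this]
    ext i j
    simp
  have hc : Continuous fun N : Matrix (Fin n) (Fin n) ℂ =>
      scV P ((N.map Complex.re) *ᵥ x) ((N.map Complex.re) *ᵥ x) := by
    have h1 : Continuous fun N : Matrix (Fin n) (Fin n) ℂ => (N.map Complex.re) *ᵥ x :=
      (continuous_id.matrix_map Complex.continuous_re).matrix_mulVec continuous_const
    exact h1.dotProduct (continuous_const.matrix_mulVec h1)
  have ht2 := (hc.tendsto 0).comp ht
  have ht3 := (tendsto_add_atTop_iff_nat 1).2 ht2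
  have hz : scV P (((0 : Matrix (Fin n) (Fin n) ℂ).map Complex.re) *ᵥ x)
      (((0 : Matrix (Fin n) (Fin n) ℂ).map Complex.re) *ᵥ x) = 0 := by
    simp [scV, Matrix.map_zero]
  rw [hz] at ht3
  have : 0 ≤ scV P (M *ᵥ x) (M *ᵥ x) := by
    refine le_of_tendsto' ht3 fun k => ?_
    have := hk k
    rw [hMk] at this
    exact this
  linarith [hdec x, hQ x hx]

lemma sc_cs {n : ℕ} {P : Matrix (Fin n) (Fin n) ℝ} (hP : P.IsHermitian)
    (hnn : ∀ x, 0 ≤ scV P x x) (u v : Fin n → ℝ) :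
    scV P u v ^ 2 ≤ scV P u u * scV P v v := by
  have h : ∀ t : ℝ, 0 ≤ scV P u u * (t * t) + 2 * scV P u v * t + scV P v v := by
    intro t
    have := hnn (t • u + v)
    simp only [scV_add_left, scV_add_right, scV_smul_left, scV_smul_right, scV_symm hP v u] at this
    linarith
  have := discrim_le_zero h
  unfold discrim at this
  linarith

/-- The scalar core. -/
lemma sc_scalar {a b s2 t2 w p q d e : ℝ} (hs : s2 = a - b) (hs0 : 0 ≤ s2) (ht0 : 0 ≤ t2)
    (hw : w ^ 2 ≤ s2 * t2) (hb : 0 < b) (ha : a ≤ p * e ^ 2) (hqb : q * e ^ 2 ≤ b)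
    (ht : t2 ≤ p * d ^ 2) (hd : 0 ≤ d) (he : 0 ≤ e) (hp : 0 ≤ p) (hq : 0 ≤ q)
    (hpd : 2 * p * d ≤ q * e) : s2 + 2 * w + t2 < a := by
  have ha0 : 0 < a := by linarith
  obtain ⟨s, hs', rfl⟩ : ∃ s, 0 ≤ s ∧ s2 = s ^ 2 := ⟨√s2, Real.sqrt_nonneg _, (Real.sq_sqrt hs0).symm⟩
  obtain ⟨t, ht', rfl⟩ : ∃ t, 0 ≤ t ∧ t2 = t ^ 2 := ⟨√t2, Real.sqrt_nonneg _, (Real.sq_sqrt ht0).symm⟩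
  obtain ⟨r, hr', rfl⟩ : ∃ r, 0 < r ∧ a = r ^ 2 := ⟨√a, Real.sqrt_pos.2 ha0, (Real.sq_sqrt ha0.le).symm⟩
  have hw' : w ≤ s * t := by
    exact (abs_le_of_sq_le_sq' (by nlinarith) (by positivity)).2
  have hsr : s < r := by nlinarith
  have h1 : (2 * (r * t)) ^ 2 ≤ (q * e ^ 2) ^ 2 := by
    have h2 : r ^ 2 * t ^ 2 ≤ (p * e ^ 2) * (p * d ^ 2) := by gcongr
    have h3 : (2 * p * d * e) ^ 2 ≤ (q * e * e) ^ 2 := by gcongr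
    nlinarith
  have h4 : 2 * (r * t) ≤ q * e ^ 2 := by
    exact (sq_le_sq₀ (by positivity) (by positivity)).1 h1
  have hst : s + t < r := by
    by_contra! hc
    rcases ht'.eq_or_lt with h | h
    · subst h; linarith
    · nlinarith [mul_pos h (sub_pos.2 hsr)]
  nlinarith

/-- Stability certificate: if K is stabilizing, Q_K ≻ 0, and P = 𝕃((A+BK)ᵀ, Q_K), then
for any direction G and stepsize 0 ≤ η ≤ λ_min(Q_K)/(2 λ_max(P) ‖BG‖₂)
(any η if BG = 0), the gain K + ηG is stabilizing. -/
theorem stability_certificate {n m : ℕ}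
    (A : Matrix (Fin n) (Fin n) ℝ) (B : Matrix (Fin n) (Fin m) ℝ)
    (K G : Matrix (Fin m) (Fin n) ℝ) (QK P : Matrix (Fin n) (Fin n) ℝ)
    (hK : specRad (A + B * K) < 1)
    (hQ : QK.PosDef)
    (hP : P = (A + B * K)ᵀ * P * (A + B * K) + QK)
    (hPh : P.IsHermitian)
    (η : ℝ) (h0 : 0 ≤ η)
    (hη : B * G = 0 ∨
      η ≤ (⨅ i, hQ.1.eigenvalues i) / (2 * (⨆ i, hPh.eigenvalues i) * specNorm (B * G))) :
    specRad (A + B * (K + η • G)) < 1 := by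
  have hN : A + B * (K + η • G) = (A + B * K) + η • (B * G) := by
    rw [Matrix.mul_add, Matrix.mul_smul, add_assoc]
  rw [hN]
  set M := A + B * K with hMdef
  set p := ⨆ i, hPh.eigenvalues i with hp
  set q := ⨅ i, hQ.1.eigenvalues i with hq
  have hQpos : ∀ x, x ≠ 0 → 0 < scV QK x x := by
    intro x hx
    simpa [scV] using hQ.dotProduct_mulVec_pos hx
  have hdec : ∀ x, scV P (M *ᵥ x) (M *ᵥ x) = scV P x x - scV QK x x := by
    intro x
    have h1 : scV P x x = scV (Mᵀ * P * M + QK) x x := by rw [← hP]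
    rw [h1]
    simp only [scV, add_mulVec, dotProduct_add, add_sub_cancel_right]
    rw [← mulVec_mulVec, ← mulVec_mulVec, dotProduct_mulVec x, vecMul_transpose]
  have hpos := sc_pos M P QK hK hdec hQpos
  have hnn : ∀ x, 0 ≤ scV P x x := by
    intro x
    by_cases h : x = 0
    · simp [h, scV]
    · exact (hpos x h).le
  have hq0 : 0 ≤ q := Real.iInf_nonneg fun i => (hQ.eigenvalues_pos i).le
  refine sc_lyap _ P hPh hpos fun x hx => ?_
  have hsq : ∀ y : Fin n → ℝ, y ⬝ᵥ y = ‖WithLp.toLp 2 y‖ ^ 2 := by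
    intro y
    rw [EuclideanSpace.real_norm_sq_eq]
    simp [dotProduct, sq]
  have hx2 := sc_le_max hPh x
  rw [hsq] at hx2
  have hp0 : 0 < p := by
    have := hpos x hx
    by_contra! hc
    nlinarith [sq_nonneg ‖WithLp.toLp 2 x‖]
  have hd2 := sc_le_max hPh ((η • (B * G)) *ᵥ x)
  have hqx := sc_min_le hQ.1 x
  rw [hsq] at hd2 hqx
  have hbound : 2 * p * ‖WithLp.toLp 2 ((η • (B * G)) *ᵥ x)‖ ≤ q * ‖WithLp.toLp 2 x‖ := by
    rcases hη with h | h
    · rw [h]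
      simp
      positivity
    · have hop : ‖WithLp.toLp 2 ((B * G) *ᵥ x)‖ ≤ specNorm (B * G) * ‖WithLp.toLp 2 x‖ := by
        have := (Matrix.toEuclideanLin (B * G)).toContinuousLinearMap.le_opNorm (WithLp.toLp 2 x)
        simpa [specNorm] using this
      have hs0 : 0 ≤ specNorm (B * G) := norm_nonneg _
      have hη2 : 2 * p * (η * specNorm (B * G)) ≤ q := by
        rcases hs0.eq_or_lt with h' | h'
        · rw [← h']; simpa using hq0
        · rw [le_div_iff₀ (by positivity)] at h
          linarith
      rw [smul_mulVec, WithLp.toLp_smul, norm_smul, Real.norm_of_nonneg h0]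
      calc 2 * p * (η * ‖WithLp.toLp 2 ((B * G) *ᵥ x)‖)
          ≤ 2 * p * (η * (specNorm (B * G) * ‖WithLp.toLp 2 x‖)) := by gcongr
        _ = 2 * p * (η * specNorm (B * G)) * ‖WithLp.toLp 2 x‖ := by ring
        _ ≤ _ := by gcongr
  have hfin := sc_scalar (hdec x) (hnn _) (hnn _)
    (sc_cs hPh hnn (M *ᵥ x) ((η • (B * G)) *ᵥ x)) (hQpos x hx) hx2 hqx hd2
    (norm_nonneg _) (norm_nonneg _) hp0.le hq0 hbound
  rw [add_mulVec]
  simp only [scV_add_left, scV_add_right]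
  rw [scV_symm hPh ((η • (B * G)) *ᵥ x) (M *ᵥ x)]
  linarith
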